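/- Let α : I → ℝ³ be a C⁴ unit-speed admissible curve in the pseudo-isotropic space Iₚ³ with RM frame {t, n₁, n₂ = b} and natural curvatures κ₁, κ₂. Then α lies on a plane—i.e., there exist u ∈ ℝ³, u ≠ 0, and d ∈ ℝ with ⟨α(s), u⟩₁ = d for all s ∈ I—if and only if the normal development (κ₁(s), κ₂(s)) lies on a line passing through the origin, i.e., there exist constants (a₁, a₂) ≠ (0,0) with a₁κ₁(s) + a₂κ₂(s) = 0 for all s ∈ I. -/

import Mathlib

noncomputable section

abbrev V3 : Type := ℝ × ℝ × ℝ

/-- The pseudo-isotropic inner product ⟨u,v⟩_{z,p} = u₁v₁ - u₂v₂. -/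
def innerZP (u v : V3) : ℝ := u.1 * v.1 - u.2.1 * v.2.1

/-- The Lorentz-Minkowski inner product ⟨u,v⟩₁ = u₁v₁ - u₂v₂ + u₃v₃. -/
def dot1 (u v : V3) : ℝ := u.1 * v.1 - u.2.1 * v.2.1 + u.2.2 * v.2.2

/-- Determinant of the three vectors u, v, w taken as rows. -/
def det3 (u v w : V3) : ℝ :=
    u.1 * (v.2.1 * w.2.2 - v.2.2 * w.2.1)
  - u.2.1 * (v.1 * w.2.2 - v.2.2 * w.1)
  + u.2.2 * (v.1 * w.2.1 - v.2.1 * w.1)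

/-- The Lorentzian cross product u ×₁ v = (u₂v₃ - u₃v₂, u₁v₃ - u₃v₁, u₁v₂ - u₂v₁). -/
def cross1 (u v : V3) : V3 :=
  (u.2.1 * v.2.2 - u.2.2 * v.2.1, u.1 * v.2.2 - u.2.2 * v.1, u.1 * v.2.1 - u.2.1 * v.1)

/-- The top view ũ = (u₁, u₂, 0) of a vector u. -/
def tildeV (u : V3) : V3 := (u.1, u.2.1, (0 : ℝ))

theorem HasDerivAt.prodFst {E F : Type*} [NormedAddCommGroup E] [NormedSpace ℝ E]
    [NormedAddCommGroup F] [NormedSpace ℝ F] {f : ℝ → E × F} {f' : E × F} {s : ℝ}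
    (hf : HasDerivAt f f' s) : HasDerivAt (fun r => (f r).1) f'.1 s := by
  simpa using (HasFDerivAt.fst hf.hasFDerivAt).hasDerivAt

theorem HasDerivAt.prodSnd {E F : Type*} [NormedAddCommGroup E] [NormedSpace ℝ E]
    [NormedAddCommGroup F] [NormedSpace ℝ F] {f : ℝ → E × F} {f' : E × F} {s : ℝ}
    (hf : HasDerivAt f f' s) : HasDerivAt (fun r => (f r).2) f'.2 s := by
  simpa using (HasFDerivAt.snd hf.hasFDerivAt).hasDerivAt

theorem HasDerivAt.dot1_const {f : ℝ → V3} {f' : V3} {s : ℝ} (hf : HasDerivAt f f' s) (u : V3) :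
    HasDerivAt (fun r => dot1 (f r) u) (dot1 f' u) s :=
  ((hf.prodFst.mul_const u.1).sub (hf.prodSnd.prodFst.mul_const u.2.1)).add (hf.prodSnd.prodSnd.mul_const u.2.2)

theorem HasDerivAt.cross1 {f g : ℝ → V3} {f' g' : V3} {s : ℝ}
    (hf : HasDerivAt f f' s) (hg : HasDerivAt g g' s) :
    HasDerivAt (fun r => cross1 (f r) (g r)) (cross1 f' (g s) + cross1 (f s) g') s := by
  have h := ((hf.prodSnd.prodFst.mul hg.prodSnd.prodSnd).sub (hf.prodSnd.prodSnd.mul hg.prodSnd.prodFst)).prodMk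
    (((hf.prodFst.mul hg.prodSnd.prodSnd).sub (hf.prodSnd.prodSnd.mul hg.prodFst)).prodMk
      ((hf.prodFst.mul hg.prodSnd.prodFst).sub (hf.prodSnd.prodFst.mul hg.prodFst)))
  refine h.congr_deriv ?_
  ext <;> simp only [_root_.cross1, Prod.fst_add, Prod.snd_add] <;> ring

theorem dot1_add_left (u v w : V3) : dot1 (u + v) w = dot1 u w + dot1 v w := by
  simp only [dot1, Prod.fst_add, Prod.snd_add]; ring

theorem dot1_smul_left (c : ℝ) (u w : V3) : dot1 (c • u) w = c * dot1 u w := by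
  simp only [dot1, Prod.smul_fst, Prod.smul_snd, smul_eq_mul]; ring

theorem dot1_cross1_self (u v : V3) : dot1 u (cross1 u v) = 0 := by
  simp only [dot1, cross1]; ring

theorem cross1_self (u : V3) : cross1 u u = 0 := by
  ext <;> simp only [cross1, Prod.fst_zero, Prod.snd_zero] <;> ring

theorem cross1_smul_left (c : ℝ) (u v : V3) : cross1 (c • u) v = c • cross1 u v := by
  ext <;> simp only [cross1, Prod.smul_fst, Prod.smul_snd, smul_eq_mul] <;> ring

theorem cross1_smul_right (c : ℝ) (u v : V3) : cross1 u (c • v) = c • cross1 u v := by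
  ext <;> simp only [cross1, Prod.smul_fst, Prod.smul_snd, smul_eq_mul] <;> ring

theorem eq_of_hasDerivAt_zero_Ioo {E : Type*} [NormedAddCommGroup E] [NormedSpace ℝ E]
    {f : ℝ → E} {a b : ℝ} (hf : ∀ s ∈ Set.Ioo a b, HasDerivAt f 0 s) {s r : ℝ}
    (hs : s ∈ Set.Ioo a b) (hr : r ∈ Set.Ioo a b) : f s = f r :=
  isOpen_Ioo.is_const_of_deriv_eq_zero isPreconnected_Ioo
    (fun s hs => (hf s hs).differentiableAt.differentiableWithinAt)
    (fun s hs => (hf s hs).deriv) hs hr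

/-- Two vectors with linearly independent top views admit no common nonzero
Lorentz-orthogonal vector of vanishing third coordinate. -/
theorem eq_zero_of_dot1_eq_zero {v w u : V3} (hD : v.1 * w.2.1 - v.2.1 * w.1 ≠ 0)
    (hv : dot1 v u = 0) (hw : dot1 w u = 0) (hu : u.2.2 = 0) : u = 0 := by
  simp only [dot1, hu, mul_zero, add_zero] at hv hw
  have h1 : (v.1 * w.2.1 - v.2.1 * w.1) * u.1 = 0 := by
    linear_combination w.2.1 * hv - v.2.1 * hw
  have h2 : (v.1 * w.2.1 - v.2.1 * w.1) * u.2.1 = 0 := by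
    linear_combination w.1 * hv - v.1 * hw
  ext
  · exact (mul_eq_zero.mp h1).resolve_left hD
  · exact (mul_eq_zero.mp h2).resolve_left hD
  · exact hu

/-- A C⁴ unit-speed admissible curve in Iₚ³ lies on a plane iff its normal development
(κ₁, κ₂) lies on a line passing through the origin. -/
theorem stmt_18
    (I : Set ℝ) (hI : ∃ a b : ℝ, I = Set.Ioo a b)
    (ε η : ℝ) (hε : ε = 1 ∨ ε = -1) (hη : η = -ε)
    (α : ℝ → V3) (hα : ContDiff ℝ 4 α)
    (x y z : ℝ → ℝ) (hcomp : ∀ s, α s = (x s, y s, z s))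
    (hunit : ∀ s ∈ I, (deriv x s) ^ 2 - (deriv y s) ^ 2 = ε)
    (hadm : ∀ s ∈ I, deriv x s * deriv (deriv y) s - deriv (deriv x) s * deriv y s ≠ 0)
    (κ : ℝ → ℝ)
    (hκdef : ∀ s, κ s = -ε * (deriv x s * deriv (deriv y) s - deriv (deriv x) s * deriv y s))
    (t : ℝ → V3) (ht : ∀ s, t s = deriv α s)
    (b : V3) (hb : b = ((0 : ℝ), (0 : ℝ), (1 : ℝ)))
    (n : ℝ → V3) (hn : ∀ s, n s = (η * κ s)⁻¹ • deriv t s)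
    (τ : ℝ → ℝ) (hτ : ∀ s ∈ I, deriv n s = (-ε * κ s) • t s + τ s • b)
    (n₁ : ℝ → V3) (hn₁d : ∀ s ∈ I, DifferentiableAt ℝ n₁ s)
    (hn₁t : ∀ s ∈ I, innerZP (n₁ s) (t s) = 0)
    (hn₁n₁ : ∀ s ∈ I, innerZP (n₁ s) (n₁ s) = η)
    (hdet : ∀ s ∈ I, det3 (t s) (n₁ s) b = det3 (t s) (n s) b)
    (hRM : ∀ s ∈ I, ∃ μ : ℝ, deriv n₁ s = μ • t s)
    (κ₁ κ₂ : ℝ → ℝ)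
    (hnat : ∀ s ∈ I, deriv t s = (η * κ₁ s) • n₁ s + κ₂ s • b)
    :
    (∃ u : V3, u ≠ 0 ∧ ∃ d : ℝ, ∀ s ∈ I, dot1 (α s) u = d) ↔
      (∃ a₁ a₂ : ℝ, (a₁, a₂) ≠ ((0 : ℝ), (0 : ℝ)) ∧
        ∀ s ∈ I, a₁ * κ₁ s + a₂ * κ₂ s = 0) := by
  obtain ⟨p, q, rfl⟩ := hI
  obtain hI | ⟨s₀, hs₀⟩ := (Set.Ioo p q).eq_empty_or_nonempty
  · simp only [hI, Set.mem_empty_iff_false, false_imp_iff, implies_true, and_true, exists_const]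
    exact ⟨fun _ => ⟨1, 0, by simp⟩, fun _ => ⟨(1, 0, 0), by simp⟩⟩
  have hη0 : η ≠ 0 := by rcases hε with rfl | rfl <;> norm_num [hη]
  have ht_eq : t = deriv α := funext ht
  have hα' : ContDiff ℝ 3 t := by
    rw [ht_eq]
    exact ((contDiff_succ_iff_deriv (n := 3)).mp hα).2.2
  have hαd (s : ℝ) : HasDerivAt α (t s) s := by
    rw [ht]
    exact (hα.differentiable (by norm_num) s).hasDerivAt
  have htd (s : ℝ) : HasDerivAt t (deriv t s) s :=
    (hα'.differentiable (by norm_num) s).hasDerivAt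
  have hx : deriv x = fun s => (t s).1 := funext fun s => by
    simpa only [hcomp] using (hαd s).prodFst.deriv
  have hy : deriv y = fun s => (t s).2.1 := funext fun s => by
    simpa only [hcomp] using (hαd s).prodSnd.prodFst.deriv
  have hx' (s : ℝ) : deriv (deriv x) s = (deriv t s).1 := by
    rw [hx]; exact (htd s).prodFst.deriv
  have hy' (s : ℝ) : deriv (deriv y) s = (deriv t s).2.1 := by
    rw [hy]; exact (htd s).prodSnd.prodFst.deriv
  have hW (s : ℝ) (hs : s ∈ Set.Ioo p q) :
      (t s).1 * (deriv t s).2.1 - (t s).2.1 * (deriv t s).1 ≠ 0 := by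
    have h := hadm s hs
    rw [hx', hy', hx, hy] at h
    rwa [mul_comm (t s).2.1]
  have htn (s : ℝ) (hs : s ∈ Set.Ioo p q) :
      (t s).1 * (deriv t s).2.1 - (t s).2.1 * (deriv t s).1 =
        η * κ₁ s * ((t s).1 * (n₁ s).2.1 - (t s).2.1 * (n₁ s).1) := by
    simp only [hnat s hs, hb, Prod.fst_add, Prod.snd_add, Prod.smul_fst, Prod.smul_snd,
      smul_eq_mul]
    ring
  have hD : (t s₀).1 * (n₁ s₀).2.1 - (t s₀).2.1 * (n₁ s₀).1 ≠ 0 := fun h =>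
    hW s₀ hs₀ (by rw [htn s₀ hs₀, h, mul_zero])
  have hκ₁ : κ₁ s₀ ≠ 0 := fun h => hW s₀ hs₀ (by rw [htn s₀ hs₀, h]; ring)
  have hbu (u : V3) : dot1 b u = u.2.2 := by simp [dot1, hb]
  constructor
  · rintro ⟨u, hu, d, hd⟩
    have hut (s : ℝ) (hs : s ∈ Set.Ioo p q) : dot1 (t s) u = 0 := by
      have hev : (fun r => dot1 (α r) u) =ᶠ[nhds s] fun _ => d :=
        Filter.eventually_of_mem (isOpen_Ioo.mem_nhds hs) hd
      rw [← ((hαd s).dot1_const u).deriv, hev.deriv_eq, deriv_const]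
    have hut' (s : ℝ) (hs : s ∈ Set.Ioo p q) : dot1 (deriv t s) u = 0 := by
      have hev : (fun r => dot1 (t r) u) =ᶠ[nhds s] fun _ => 0 :=
        Filter.eventually_of_mem (isOpen_Ioo.mem_nhds hs) hut
      rw [← ((htd s).dot1_const u).deriv, hev.deriv_eq, deriv_const]
    have hconst (s : ℝ) (hs : s ∈ Set.Ioo p q) : dot1 (n₁ s) u = dot1 (n₁ s₀) u := by
      refine eq_of_hasDerivAt_zero_Ioo (f := fun r => dot1 (n₁ r) u) (fun r hr => ?_) hs hs₀
      obtain ⟨μ, hμ⟩ := hRM r hr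
      refine ((hn₁d r hr).hasDerivAt.dot1_const u).congr_deriv ?_
      rw [hμ, dot1_smul_left, hut r hr, mul_zero]
    refine ⟨η * dot1 (n₁ s₀) u, u.2.2, fun h => ?_, fun s hs => ?_⟩
    · obtain ⟨h1, h2⟩ := Prod.mk.inj h
      exact hu (eq_zero_of_dot1_eq_zero hD (hut s₀ hs₀)
        ((mul_eq_zero.mp h1).resolve_left hη0) h2)
    · have h := hut' s hs
      rw [hnat s hs, dot1_add_left, dot1_smul_left, dot1_smul_left, hconst s hs, hbu] at h
      linear_combination h
  · rintro ⟨a₁, a₂, ha, hline⟩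
    have ha₂ : a₂ ≠ 0 := by
      rintro rfl
      have h := hline s₀ hs₀
      rw [zero_mul, add_zero] at h
      exact ha (by rw [(mul_eq_zero.mp h).resolve_right hκ₁])
    -- The field `n₁ + c • b` is parallel to `t'`, so its cross product with `t` is constant.
    set c : ℝ := -(a₁ / a₂) / η with hc
    have ht' (s : ℝ) (hs : s ∈ Set.Ioo p q) : deriv t s = (η * κ₁ s) • (n₁ s + c • b) := by
      have hκ₂ : κ₂ s = η * κ₁ s * c := by
        rw [hc]
        field_simp
        linear_combination hline s hs
      rw [hnat s hs, smul_add, smul_smul, hκ₂]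
    have hconst (s : ℝ) (hs : s ∈ Set.Ioo p q) :
        cross1 (t s) (n₁ s + c • b) = cross1 (t s₀) (n₁ s₀ + c • b) := by
      refine eq_of_hasDerivAt_zero_Ioo (f := fun r => cross1 (t r) (n₁ r + c • b))
        (fun r hr => ?_) hs hs₀
      obtain ⟨μ, hμ⟩ := hRM r hr
      refine ((htd r).cross1 ((hn₁d r hr).hasDerivAt.add_const (c • b))).congr_deriv ?_
      rw [hμ, ht' r hr, cross1_smul_left, cross1_smul_right, cross1_self, cross1_self,
        smul_zero, smul_zero, add_zero]
    refine ⟨cross1 (t s₀) (n₁ s₀ + c • b), fun h => hD ?_, _, fun s hs =>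
      eq_of_hasDerivAt_zero_Ioo
        (f := fun r => dot1 (α r) (cross1 (t s₀) (n₁ s₀ + c • b))) (fun r hr => ?_) hs hs₀⟩
    · simpa [cross1, hb] using congrArg (fun v : V3 => v.2.2) h
    · refine ((hαd r).dot1_const _).congr_deriv ?_
      rw [← hconst r hr, dot1_cross1_self]
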